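/- Suppose 0 < ε < 10^{-5} and t, n are integers with t ≥ 2 and n ≥ ε^{-2}. Suppose V_0, …, V_{t−1} are disjoint vertex sets in a graph, indexed by the elements of Z/tZ, such that for each i ∈ Z/tZ: |V_i| ≥ n, the pair (V_i, V_{i+1}) is ε-regular, and d(V_i, V_{i+1}) ≥ d for some d ≥ 5ε^{1/2}. Then for any integer ℓ with 2 ≤ ℓ ≤ t(1−√ε)n and any vertex w_0 ∈ V_0 having at least (d−ε)|V_1| neighbors in V_1, the number of (V_0, …, V_{t−1})-transversal paths of length ℓ starting from w_0 is at least (d − ε − √ε)^ℓ · ∏_{i=1}^{ℓ} (n − ⌊i/t⌋). -/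

import Mathlib

open Finset
open scoped Classical

noncomputable section

/-- Number of ordered pairs `(x, y) ∈ X × Y` that are adjacent in `G`. -/
def interPairs {V : Type*} (G : SimpleGraph V) (X Y : Finset V) : ℕ :=
  ((X ×ˢ Y).filter fun p => G.Adj p.1 p.2).card

/-- The edge density `d(X, Y) = e(X, Y) / (|X| |Y|)` between disjoint sets `X` and `Y`. -/
def dens {V : Type*} (G : SimpleGraph V) (X Y : Finset V) : ℝ :=
  (interPairs G X Y : ℝ) / ((X.card : ℝ) * (Y.card : ℝ))

/-- `(X, Y)` is an `ε`-regular pair. -/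
def IsRegularPair {V : Type*} (G : SimpleGraph V) (ε : ℝ) (X Y : Finset V) : Prop :=
  ∀ U ⊆ X, ∀ W ⊆ Y, ε * X.card ≤ (U.card : ℝ) → ε * Y.card ≤ (W.card : ℝ) →
    |dens G U W - dens G X Y| ≤ ε

/-- The number of `(V_0, …, V_{t-1})`-transversal paths of length `ℓ` starting from `w₀`:
sequences of distinct vertices `w_0 = w₀, w_1, …, w_ℓ` with consecutive vertices adjacent
and `w_i ∈ V_{i mod t}` for all `i`. -/
def transversalPathsFrom {V : Type*} (G : SimpleGraph V) {t : ℕ}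
    (Vs : ZMod t → Finset V) (ℓ : ℕ) (w₀ : V) : ℕ :=
  Nat.card {w : Fin (ℓ + 1) → V // w 0 = w₀ ∧ Function.Injective w ∧
    (∀ i : Fin ℓ, G.Adj (w i.castSucc) (w i.succ)) ∧
    ∀ i : Fin (ℓ + 1), w i ∈ Vs ((i : ℕ) : ZMod t)}

theorem interPairs_eq_sum {V : Type*} (G : SimpleGraph V) (X Y : Finset V) :
    interPairs G X Y = ∑ x ∈ X, (Y.filter fun y => G.Adj x y).card := by
  simp only [interPairs, Finset.card_filter, Finset.sum_product]

/-- In an `ε`-regular pair of density at least `d`, few vertices of one side have fewer than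
`(d - ε) |W|` neighbours in a large subset `W` of the other side. -/
theorem IsRegularPair.card_low_degree_lt {V : Type*} {G : SimpleGraph V} {ε d : ℝ}
    {X Y W : Finset V} (h : IsRegularPair G ε X Y) (hε : 0 < ε) (hX : X.Nonempty)
    (hY : Y.Nonempty) (hd : d ≤ dens G X Y) (hWY : W ⊆ Y) (hW : ε * Y.card ≤ W.card) :
    ((X.filter fun x => ((W.filter fun y => G.Adj x y).card : ℝ) < (d - ε) * W.card).card : ℝ)
      < ε * X.card := by
  by_contra! hcon
  set U := X.filter fun x => ((W.filter fun y => G.Adj x y).card : ℝ) < (d - ε) * W.card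
    with hU
  have hX' : (0 : ℝ) < X.card := by exact_mod_cast hX.card_pos
  have hY' : (0 : ℝ) < Y.card := by exact_mod_cast hY.card_pos
  have hUpos : (0 : ℝ) < U.card := (mul_pos hε hX').trans_le hcon
  have hWpos : (0 : ℝ) < W.card := (mul_pos hε hY').trans_le hW
  have hUne : U.Nonempty := Finset.card_pos.mp (by exact_mod_cast hUpos)
  have hdUW : d - ε ≤ dens G U W := by
    have := (abs_le.mp (h U (Finset.filter_subset _ _) W hWY hcon hW)).1
    linarith
  rw [_root_.dens, le_div_iff₀ (mul_pos hUpos hWpos), interPairs_eq_sum] at hdUW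
  push_cast at hdUW
  have hlt : ∑ x ∈ U, ((W.filter fun y => G.Adj x y).card : ℝ)
      < ∑ _x ∈ U, (d - ε) * (W.card : ℝ) :=
    Finset.sum_lt_sum_of_nonempty hUne fun x hx => (Finset.mem_filter.mp hx).2
  rw [Finset.sum_const, nsmul_eq_mul] at hlt
  linarith

/-- `w` is a `(V_0, …, V_{t-1})`-transversal path of length `k` starting from `w₀`. -/
def IsTransversalPath {V : Type*} (G : SimpleGraph V) {t : ℕ} (Vs : ZMod t → Finset V)
    (w₀ : V) (k : ℕ) (w : Fin (k + 1) → V) : Prop :=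
  w 0 = w₀ ∧ Function.Injective w ∧ (∀ i : Fin k, G.Adj (w i.castSucc) (w i.succ)) ∧
    ∀ i : Fin (k + 1), w i ∈ Vs ((i : ℕ) : ZMod t)

/-- The vertices of `Vs m` not visited by `w`. -/
def unvisited {V : Type*} {t : ℕ} (Vs : ZMod t → Finset V) {k : ℕ} (w : Fin k → V) (m : ℕ) :
    Finset V :=
  Vs (m : ZMod t) \ Finset.univ.image w

theorem IsTransversalPath.snoc {V : Type*} {G : SimpleGraph V} {t : ℕ} {Vs : ZMod t → Finset V}
    {w₀ : V} {k : ℕ} {w : Fin (k + 1) → V} (h : IsTransversalPath G Vs w₀ k w) {v : V}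
    (hv : v ∈ unvisited Vs w (k + 1)) (hadj : G.Adj (w (Fin.last k)) v) :
    IsTransversalPath G Vs w₀ (k + 1) (Fin.snoc w v) := by
  obtain ⟨h0, hinj, hwadj, hmem⟩ := h
  simp only [unvisited, Finset.mem_sdiff, Finset.mem_image, Finset.mem_univ, true_and] at hv
  refine ⟨?_, ?_, ?_, ?_⟩
  · rw [← Fin.castSucc_zero, Fin.snoc_castSucc, h0]
  · exact Fin.snoc_injective_iff.mpr ⟨hinj, hv.2⟩
  · intro i
    induction i using Fin.lastCases with
    | last => simpa [Fin.succ_last] using hadj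
    | cast i => simpa only [Fin.snoc_castSucc, Fin.succ_castSucc] using hwadj i
  · intro i
    induction i using Fin.lastCases with
    | last => simpa using hv.1
    | cast i => simpa using hmem i

/-- A transversal path of length `k` has visited at most `(k + 1) / t` vertices of the set its
next vertex is to be taken from. -/
theorem IsTransversalPath.card_le_card_unvisited_add {V : Type*} {G : SimpleGraph V} {t : ℕ}
    {Vs : ZMod t → Finset V} {w₀ : V} {k : ℕ} {w : Fin (k + 1) → V} (ht : 0 < t)
    (hdisj : ∀ i j : ZMod t, i ≠ j → Disjoint (Vs i) (Vs j))
    (h : IsTransversalPath G Vs w₀ k w) :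
    (Vs ((k + 1 : ℕ) : ZMod t)).card ≤ (unvisited Vs w (k + 1)).card + (k + 1) / t := by
  have hcount : ((Finset.range (k + 1)).filter fun i => i ≡ k + 1 [MOD t]).card
      = (k + 1) / t := by
    rw [← Nat.count_eq_card_filter_range, Nat.count_modEq_card _ ht]
    simp
  have hsub : Vs ((k + 1 : ℕ) : ZMod t) \ unvisited Vs w (k + 1) ⊆
      (Finset.univ.filter fun i : Fin (k + 1) => (i : ℕ) ≡ k + 1 [MOD t]).image w := by
    intro v hv
    simp only [unvisited, Finset.mem_sdiff, Finset.mem_image, Finset.mem_univ, true_and,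
      not_and, not_not] at hv
    obtain ⟨i, rfl⟩ := hv.2 hv.1
    refine Finset.mem_image.mpr ⟨i, Finset.mem_filter.mpr ⟨Finset.mem_univ _, ?_⟩, rfl⟩
    by_contra hne
    exact Finset.disjoint_left.mp
      (hdisj _ _ fun heq => hne ((ZMod.natCast_eq_natCast_iff _ _ _).mp heq)) (h.2.2.2 i) hv.1
  have hcard : (Finset.univ.filter fun i : Fin (k + 1) => (i : ℕ) ≡ k + 1 [MOD t]).card
      ≤ (k + 1) / t := by
    rw [← hcount]
    refine Finset.card_le_card_of_injOn (fun i => (i : ℕ)) ?_ Fin.val_injective.injOn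
    intro i hi
    have hi' := (Finset.mem_filter.mp hi).2
    exact Finset.mem_filter.mpr ⟨Finset.mem_range.mpr i.isLt, hi'⟩
  have := (Finset.card_le_card hsub).trans (Finset.card_image_le.trans hcard)
  have := Finset.le_card_sdiff (unvisited Vs w (k + 1)) (Vs ((k + 1 : ℕ) : ZMod t))
  omega

theorem unvisited_snoc {V : Type*} {t : ℕ} (ht : 2 ≤ t) {Vs : ZMod t → Finset V}
    (hdisj : ∀ i j : ZMod t, i ≠ j → Disjoint (Vs i) (Vs j)) {k m : ℕ} (w : Fin k → V) {v : V}
    (hv : v ∈ Vs (m : ZMod t)) :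
    unvisited Vs (Fin.snoc w v : Fin (k + 1) → V) (m + 1) = unvisited Vs w (m + 1) := by
  have hne : (m : ZMod t) ≠ ((m + 1 : ℕ) : ZMod t) := by
    have : Fact (1 < t) := ⟨ht⟩
    simp
  ext x
  simp only [unvisited, Finset.mem_sdiff, Finset.mem_image, Finset.mem_univ, true_and,
    Fin.exists_fin_succ', Fin.snoc_castSucc, Fin.snoc_last]
  refine and_congr_right fun hx => not_congr ⟨?_, Or.inl⟩
  rintro (h | rfl)
  · exact h
  · exact (Finset.disjoint_left.mp (hdisj _ _ hne) hv hx).elim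

/-- If every tuple in `S` has at least `c` one-step extensions in `T`, then `T` has at least
`c |S|` elements. -/
theorem mul_card_le_card_of_snoc {V : Type*} [Fintype V] {k : ℕ} {c : ℝ}
    {S : Finset (Fin k → V)} {T : Finset (Fin (k + 1) → V)}
    (h : ∀ w ∈ S, ∃ A : Finset V, c ≤ A.card ∧ ∀ v ∈ A, (Fin.snoc w v : Fin (k + 1) → V) ∈ T) :
    c * S.card ≤ T.card := by
  choose! A hA hAT using h
  have hsum : ∑ _w ∈ S, c ≤ ∑ w ∈ S, ((A w).card : ℝ) := Finset.sum_le_sum hA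
  rw [Finset.sum_const, nsmul_eq_mul, mul_comm] at hsum
  refine hsum.trans ?_
  rw [← Nat.cast_sum, Nat.cast_le, ← Finset.card_sigma]
  refine Finset.card_le_card_of_injOn (fun p => (Fin.snoc p.1 p.2 : Fin (k + 1) → V)) ?_ ?_
  · rintro ⟨w, v⟩ hp
    obtain ⟨hw, hv⟩ := Finset.mem_sigma.mp hp
    exact hAT w hw v hv
  · rintro ⟨w, v⟩ - ⟨w', v'⟩ - heq
    obtain ⟨rfl, rfl⟩ := Fin.snoc_inj.mp heq
    rfl

/-- The neighbours of the endpoint of `w` through which `w` extends to a transversal path. -/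
def extensions {V : Type*} (G : SimpleGraph V) {t : ℕ} (Vs : ZMod t → Finset V) {k : ℕ}
    (w : Fin (k + 1) → V) : Finset V :=
  (unvisited Vs w (k + 1)).filter fun v => G.Adj (w (Fin.last k)) v

theorem stmt_2 {V : Type*} [Fintype V] (G : SimpleGraph V) (ε d : ℝ)
    (hε0 : 0 < ε) (hε : ε < (10 : ℝ) ^ (-5 : ℤ))
    (t n : ℕ) (ht : 2 ≤ t) (hn : ε⁻¹ ^ 2 ≤ (n : ℝ))
    (Vs : ZMod t → Finset V)
    (hdisj : ∀ i j : ZMod t, i ≠ j → Disjoint (Vs i) (Vs j))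
    (hsize : ∀ i : ZMod t, n ≤ (Vs i).card)
    (hreg : ∀ i : ZMod t, IsRegularPair G ε (Vs i) (Vs (i + 1)))
    (hdens : ∀ i : ZMod t, d ≤ dens G (Vs i) (Vs (i + 1)))
    (hd : 5 * Real.sqrt ε ≤ d)
    (ℓ : ℕ) (hℓ2 : 2 ≤ ℓ) (hℓ : (ℓ : ℝ) ≤ t * (1 - Real.sqrt ε) * n)
    (w₀ : V) (hw₀ : w₀ ∈ Vs 0)
    (hdeg : (d - ε) * (Vs 1).card ≤ (((Vs 1).filter fun v => G.Adj w₀ v).card : ℝ)) :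
    (d - ε - Real.sqrt ε) ^ ℓ * ∏ i ∈ Finset.Icc 1 ℓ, ((n : ℝ) - (i / t : ℕ)) ≤
      (transversalPathsFrom G Vs ℓ w₀ : ℝ) := by
  have hs0 : 0 < Real.sqrt ε := Real.sqrt_pos.mpr hε0
  have hss : Real.sqrt ε * Real.sqrt ε = ε := Real.mul_self_sqrt hε0.le
  have hs1 : Real.sqrt ε < 1 := by
    rw [Real.sqrt_lt' one_pos]
    refine hε.trans ?_
    norm_num
  set s := Real.sqrt ε
  have hn0 : (0 : ℝ) < n := lt_of_lt_of_le (by positivity) hn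
  have hcs : 0 ≤ d - ε - s := by nlinarith
  have ht0 : 0 < t := by omega
  have hVne (i : ZMod t) : (Vs i).Nonempty :=
    Finset.card_pos.mp (lt_of_lt_of_le (by exact_mod_cast hn0) (hsize i))
  have hdiv {k : ℕ} (hk : k ≤ ℓ) : ((k / t : ℕ) : ℝ) ≤ (1 - s) * n := by
    refine Nat.cast_div_le.trans ?_
    rw [div_le_iff₀ (by exact_mod_cast ht0)]
    have : (k : ℝ) ≤ ℓ := by exact_mod_cast hk
    linarith
  have hc {k : ℕ} (hk : k + 1 ≤ ℓ) : 0 ≤ (d - ε - s) * ((n : ℝ) - ((k + 1) / t : ℕ)) := by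
    refine mul_nonneg hcs ?_
    have := hdiv hk
    nlinarith
  have hsizeR (i : ZMod t) : (n : ℝ) ≤ (Vs i).card := by exact_mod_cast hsize i
  have hroom {k : ℕ} {w : Fin (k + 1) → V} (hw : IsTransversalPath G Vs w₀ k w) :
      ((Vs ((k + 1 : ℕ) : ZMod t)).card : ℝ) - ((k + 1) / t : ℕ)
        ≤ (unvisited Vs w (k + 1)).card := by
    rw [sub_le_iff_le_add]
    exact_mod_cast hw.card_le_card_unvisited_add ht0 hdisj
  have hlarge {k : ℕ} (hk : k + 1 ≤ ℓ) {w : Fin (k + 1) → V}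
      (hw : IsTransversalPath G Vs w₀ k w) :
      s * (Vs ((k + 1 : ℕ) : ZMod t)).card ≤ (unvisited Vs w (k + 1)).card := by
    have h₁ := hroom hw
    have h₂ := hdiv hk
    have h₃ := mul_le_mul_of_nonneg_left (hsizeR ((k + 1 : ℕ) : ZMod t)) (sub_nonneg.mpr hs1.le)
    linarith
  let good (k : ℕ) : Finset (Fin (k + 1) → V) := Finset.univ.filter fun w =>
    IsTransversalPath G Vs w₀ k w ∧
      (d - ε) * (unvisited Vs w (k + 1)).card ≤ ((extensions G Vs w).card : ℝ)
  have hext {k : ℕ} {w : Fin (k + 1) → V} (hw : IsTransversalPath G Vs w₀ k w) {v : V}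
      (hv : v ∈ extensions G Vs w) : IsTransversalPath G Vs w₀ (k + 1) (Fin.snoc w v) := by
    obtain ⟨hv, hadj⟩ := Finset.mem_filter.mp hv
    exact hw.snoc hv hadj
  have hstep (k : ℕ) (hk : k + 2 ≤ ℓ) :
      (d - ε - s) * ((n : ℝ) - ((k + 1) / t : ℕ)) * (good k).card ≤ (good (k + 1)).card := by
    refine mul_card_le_card_of_snoc fun w hw => ?_
    obtain ⟨hpath, hdegw⟩ := (Finset.mem_filter.mp hw).2
    set W := unvisited Vs w (k + 1 + 1) with hW
    set bad := (Vs ((k + 1 : ℕ) : ZMod t)).filter fun x =>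
      ((W.filter fun y => G.Adj x y).card : ℝ) < (d - ε) * W.card
    refine ⟨extensions G Vs w \ bad, ?_, ?_⟩
    · have hnext : ((k + 1 : ℕ) : ZMod t) + 1 = ((k + 1 + 1 : ℕ) : ZMod t) := by push_cast; ring
      by_cases hne : (extensions G Vs w).Nonempty
      · obtain ⟨v, hv⟩ := hne
        have hvmem : v ∈ Vs ((k + 1 : ℕ) : ZMod t) :=
          (Finset.mem_sdiff.mp (Finset.mem_filter.mp hv).1).1
        have hWlarge : ε * (Vs ((k + 1 + 1 : ℕ) : ZMod t)).card ≤ W.card := by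
          have := hlarge hk (hext hpath hv)
          rw [unvisited_snoc ht hdisj w hvmem] at this
          refine le_trans (mul_le_mul_of_nonneg_right ?_ (Nat.cast_nonneg _)) this
          nlinarith
        have hbad : (bad.card : ℝ) < ε * (Vs ((k + 1 : ℕ) : ZMod t)).card :=
          (hnext ▸ hreg ((k + 1 : ℕ) : ZMod t)).card_low_degree_lt hε0 (hVne _) (hVne _)
            (hnext ▸ hdens ((k + 1 : ℕ) : ZMod t)) Finset.sdiff_subset hWlarge
        have hdiff : ((extensions G Vs w).card : ℝ) - bad.card
            ≤ (extensions G Vs w \ bad).card := by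
          rw [sub_le_iff_le_add]
          exact_mod_cast Nat.sub_le_iff_le_add.mp (Finset.le_card_sdiff bad (extensions G Vs w))
        have h₁ := mul_le_mul_of_nonneg_left (hlarge (by omega : k + 1 ≤ ℓ) hpath) hs0.le
        rw [← mul_assoc, hss] at h₁
        have h₂ := mul_le_mul_of_nonneg_left (hroom hpath) hcs
        have h₃ := mul_le_mul_of_nonneg_left (hsizeR ((k + 1 : ℕ) : ZMod t)) hcs
        linarith
      · rw [Finset.not_nonempty_iff_eq_empty] at hne
        rw [hne, Finset.card_empty, Nat.cast_zero] at hdegw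
        have h₁ := mul_le_mul_of_nonneg_left (hroom hpath) hcs
        have h₂ := mul_le_mul_of_nonneg_left (hsizeR ((k + 1 : ℕ) : ZMod t)) hcs
        have h₃ : 0 ≤ s * ((unvisited Vs w (k + 1)).card : ℝ) := by positivity
        have h₄ : (0 : ℝ) ≤ (extensions G Vs w \ bad).card := Nat.cast_nonneg _
        linarith
    · intro v hv
      obtain ⟨hv, hvbad⟩ := Finset.mem_sdiff.mp hv
      have hvmem : v ∈ Vs ((k + 1 : ℕ) : ZMod t) :=
        (Finset.mem_sdiff.mp (Finset.mem_filter.mp hv).1).1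
      refine Finset.mem_filter.mpr ⟨Finset.mem_univ _, hext hpath hv, ?_⟩
      rw [extensions, unvisited_snoc ht hdisj w hvmem, ← hW, Fin.snoc_last]
      by_contra! hlt
      exact hvbad (Finset.mem_filter.mpr ⟨hvmem, hlt⟩)
  have hgood (k : ℕ) (hk : k + 1 ≤ ℓ) :
      (d - ε - s) ^ k * ∏ i ∈ Finset.Icc 1 k, ((n : ℝ) - (i / t : ℕ)) ≤ (good k).card := by
    induction k with
    | zero =>
      have hunv : unvisited Vs (fun _ : Fin 1 => w₀) (0 + 1) = Vs 1 := by
        have : Fact (1 < t) := ⟨ht⟩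
        rw [unvisited, zero_add, Nat.cast_one, Finset.sdiff_eq_self_iff_disjoint]
        refine (hdisj 1 0 one_ne_zero).mono_right ?_
        simpa [Finset.subset_iff] using hw₀
      have hmem : (fun _ => w₀) ∈ good 0 := by
        refine Finset.mem_filter.mpr ⟨Finset.mem_univ _,
          ⟨rfl, fun i j _ => Subsingleton.elim (α := Fin 1) i j, fun i => i.elim0, ?_⟩, ?_⟩
        · intro i
          simpa [Fin.eq_zero i] using hw₀
        · rw [extensions, hunv]
          exact hdeg
      simpa using Finset.card_pos.mpr ⟨_, hmem⟩
    | succ k ih =>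
      refine le_trans ?_ (hstep k hk)
      rw [Finset.prod_Icc_succ_top (by omega), pow_succ]
      calc _ = (d - ε - s) * ((n : ℝ) - ((k + 1) / t : ℕ)) *
            ((d - ε - s) ^ k * ∏ i ∈ Finset.Icc 1 k, ((n : ℝ) - (i / t : ℕ))) := by ring
        _ ≤ _ := mul_le_mul_of_nonneg_left (ih (by omega)) (hc (by omega))
  obtain ⟨k, rfl⟩ : ∃ k, ℓ = k + 1 := ⟨ℓ - 1, by omega⟩
  have hlast : (d - ε - s) * ((n : ℝ) - ((k + 1) / t : ℕ)) * (good k).card ≤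
      (Finset.univ.filter fun w => IsTransversalPath G Vs w₀ (k + 1) w).card := by
    refine mul_card_le_card_of_snoc fun w hw => ?_
    obtain ⟨hpath, hdegw⟩ := (Finset.mem_filter.mp hw).2
    refine ⟨extensions G Vs w, ?_, fun v hv =>
      Finset.mem_filter.mpr ⟨Finset.mem_univ _, hext hpath hv⟩⟩
    have h₁ := mul_le_mul_of_nonneg_left (hroom hpath) hcs
    have h₂ := mul_le_mul_of_nonneg_left (hsizeR ((k + 1 : ℕ) : ZMod t)) hcs
    have h₃ : 0 ≤ s * ((unvisited Vs w (k + 1)).card : ℝ) := by positivity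
    linarith
  have hcard : transversalPathsFrom G Vs (k + 1) w₀
      = (Finset.univ.filter fun w => IsTransversalPath G Vs w₀ (k + 1) w).card := by
    rw [← Fintype.card_subtype, ← Nat.card_eq_fintype_card]
    rfl
  rw [hcard, Finset.prod_Icc_succ_top (by omega), pow_succ]
  refine le_trans ?_ hlast
  calc _ = (d - ε - s) * ((n : ℝ) - ((k + 1) / t : ℕ)) *
        ((d - ε - s) ^ k * ∏ i ∈ Finset.Icc 1 k, ((n : ℝ) - (i / t : ℕ))) := by ring
    _ ≤ _ := mul_le_mul_of_nonneg_left (hgood k le_rfl) (hc le_rfl)
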